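/- For t ∈ (0,1], the infinite series Z_∞(t) := ∑_{k=1}^∞ Y_k(t) converges if and only if t ∈ (0,1); in particular it diverges at t = 1. -/

import Mathlib

open MeasureTheory Real Set

noncomputable def X1 (t : ℝ) : ℝ := (1 - Real.log t)⁻¹

/-- Iterated logarithmic function: `XX 0 t = t`, `XX (k+1) t = X1 (XX k t)`;
so `XX 1 = X_1`, `XX 2 = X_2`, ... of the paper. -/
noncomputable def XX : ℕ → ℝ → ℝ
  | 0, t => t
  | k + 1, t => X1 (XX k t)

/-- `YY k t = ∏_{i=1}^k X_i(t)`, with `YY 0 = 1`. -/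
noncomputable def YY (k : ℕ) (t : ℝ) : ℝ := ∏ i ∈ Finset.Icc 1 k, XX i t

/-- `ZZ k t = ∑_{i=1}^k Y_i(t)`, with `ZZ 0 = 0`. -/
noncomputable def ZZ (k : ℕ) (t : ℝ) : ℝ := ∑ i ∈ Finset.Icc 1 k, YY i t

/-- The quantity `I_k[u; D]` of the paper. -/
noncomputable def Ik (n : ℕ) (p D : ℝ) (Ω : Set (EuclideanSpace ℝ (Fin n))) (k : ℕ)
    (u : EuclideanSpace ℝ (Fin n) → ℝ) : ℝ :=
  (∫ x in Ω, ‖fderiv ℝ u x‖ ^ p)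
    - |((n : ℝ) - p) / p| ^ p * ∫ x in Ω, |u x| ^ p / ‖x‖ ^ p
    - ((p - 1) / (2 * p)) * |((n : ℝ) - p) / p| ^ (p - 2) *
        ∫ x in Ω, (|u x| ^ p / ‖x‖ ^ p) * ∑ i ∈ Finset.Icc 1 k, (YY i (‖x‖ / D)) ^ 2

theorem inv_X1 (x : ℝ) : (X1 x)⁻¹ = 1 + Real.log x⁻¹ := by
  rw [X1, inv_inv, Real.log_inv, sub_eq_add_neg]

theorem one_lt_inv_XX {t : ℝ} (ht : t ∈ Set.Ioo (0 : ℝ) 1) (k : ℕ) : 1 < (XX k t)⁻¹ := by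
  induction k with
  | zero => exact (one_lt_inv₀ ht.1).2 ht.2
  | succ k ih =>
    rw [XX, inv_X1]
    linarith [Real.log_pos ih]

theorem XX_pos {t : ℝ} (ht : t ∈ Set.Ioo (0 : ℝ) 1) (k : ℕ) : 0 < XX k t :=
  inv_pos.1 (zero_lt_one.trans (one_lt_inv_XX ht k))

theorem YY_succ (k : ℕ) (t : ℝ) : YY (k + 1) t = YY k t * XX (k + 1) t :=
  Finset.prod_Icc_succ_top (by omega) _

theorem YY_pos {t : ℝ} (ht : t ∈ Set.Ioo (0 : ℝ) 1) (k : ℕ) : 0 < YY k t :=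
  Finset.prod_pos fun i _ => XX_pos ht i

/-- The gaps between consecutive `1 / X_k` shrink at most by the factor `X_k`. -/
theorem mul_XX_le_inv_XX_sub {t : ℝ} (ht : t ∈ Set.Ioo (0 : ℝ) 1) (k : ℕ) :
    ((XX k t)⁻¹ - (XX (k + 1) t)⁻¹) * XX k t ≤ (XX (k + 1) t)⁻¹ - (XX (k + 2) t)⁻¹ := by
  have hx := XX_pos ht k
  have hy := XX_pos ht (k + 1)
  have h := Real.one_sub_inv_le_log_of_pos (div_pos hy hx)
  rw [Real.log_div hy.ne' hx.ne'] at h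
  have e₁ : (XX (k + 1) t)⁻¹ = 1 - Real.log (XX k t) := by
    rw [XX, inv_X1, Real.log_inv, sub_eq_add_neg]
  have e₂ : (XX (k + 2) t)⁻¹ = 1 - Real.log (XX (k + 1) t) := by
    rw [XX, inv_X1, Real.log_inv, sub_eq_add_neg]
  calc ((XX k t)⁻¹ - (XX (k + 1) t)⁻¹) * XX k t = 1 - (XX (k + 1) t / XX k t)⁻¹ := by
        field_simp
    _ ≤ (XX (k + 1) t)⁻¹ - (XX (k + 2) t)⁻¹ := by linarith

theorem mul_YY_le_inv_XX_sub {t : ℝ} (ht : t ∈ Set.Ioo (0 : ℝ) 1) (k : ℕ) :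
    ((XX 1 t)⁻¹ - (XX 2 t)⁻¹) * YY k t ≤ (XX (k + 1) t)⁻¹ - (XX (k + 2) t)⁻¹ := by
  induction k with
  | zero => simp [YY]
  | succ k ih =>
    rw [YY_succ, ← mul_assoc]
    exact (mul_le_mul_of_nonneg_right ih (XX_pos ht _).le).trans (mul_XX_le_inv_XX_sub ht _)

theorem summable_YY {t : ℝ} (ht : t ∈ Set.Ioo (0 : ℝ) 1) : Summable fun k => YY k t := by
  have hd : 0 < (XX 1 t)⁻¹ - (XX 2 t)⁻¹ := by
    have h := one_lt_inv_XX ht 1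
    have hlog := Real.log_lt_sub_one_of_pos (zero_lt_one.trans h) h.ne'
    have e : (XX 2 t)⁻¹ = 1 + Real.log (XX 1 t)⁻¹ := inv_X1 _
    linarith
  refine (summable_mul_left_iff hd.ne').1 <|
    summable_of_sum_range_le (c := (XX 1 t)⁻¹) (fun k => (mul_pos hd (YY_pos ht k)).le) fun n => ?_
  refine (Finset.sum_le_sum fun k _ => mul_YY_le_inv_XX_sub ht k).trans ?_
  rw [Finset.sum_range_sub' fun k => (XX (k + 1) t)⁻¹]
  linarith [one_lt_inv_XX ht (n + 1)]

theorem XX_one_right (k : ℕ) : XX k 1 = 1 := by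
  induction k with
  | zero => rfl
  | succ k ih => simp [XX, X1, ih]

/-- The series `Z_∞(t) = ∑_{k≥1} Y_k(t)` converges iff `t ∈ (0,1)`;
in particular it diverges at `t = 1`. -/
theorem summable_Y_iff (t : ℝ) (ht : t ∈ Set.Ioc (0 : ℝ) 1) :
    Summable (fun k : ℕ => YY (k + 1) t) ↔ t ∈ Set.Ioo (0 : ℝ) 1 := by
  refine ⟨fun h => ⟨ht.1, ht.2.lt_of_ne ?_⟩,
    fun h => (summable_nat_add_iff (f := fun k => YY k t) 1).2 (summable_YY h)⟩
  rintro rfl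
  simp [YY, XX_one_right, summable_const_iff] at h
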